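/- arXiv:1602.05418 — 2 statements merged into one kernel-verified Lean document; each statement's English description precedes it below -/
import Mathlib

section
/- Let d and m be integers with d ≥ 4 and m ≥ 2, let n_R and ē be natural numbers, and let a, b, c : ℕ → ℕ be finitely supported functions with a(r) = b(r) = c(r) = 0 unless 2 ≤ r ≤ m. Set n = n_R + ∑_r (r−1)·b(r), k = n + m + ē, and t(r) = a(r) + b(r) + c(r). Assume n_R ≤ ∑_r r·c(r) and m + ē ≤ ∑_r r·a(r). Then (d−2)·k + ∑_r ( r − m(d−1) )·t(r) ≤ 0. In particular, if ∑_r t(r) > 0, then −( (d−2)·k + ∑_r r·t(r) ) / ( ∑_r t(r) ) ≥ −m(d−1). -/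
/-- Combinatorial core of Theorem 3.4 (Laface–Pokora): bound `-m(d-1)` on the
Harbourne index of a connected configuration of lines on a smooth degree-`d`
surface in `ℙ³` whose maximal multiplicity of a singular point is `m`. -/
theorem stmt_2 (d : ℤ) (m : ℕ) (hd : 4 ≤ d) (hm : 2 ≤ m) (nR e : ℕ)
    (a b c : ℕ →₀ ℕ)
    (hsupp : ∀ r : ℕ, ¬(2 ≤ r ∧ r ≤ m) → a r = 0 ∧ b r = 0 ∧ c r = 0)
    (n : ℕ) (hn : n = nR + ∑ r ∈ b.support, (r - 1) * b r)
    (k : ℤ) (hk : k = (n : ℤ) + m + e)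
    (t : ℕ → ℕ) (ht : ∀ r, t r = a r + b r + c r)
    (hnR : (nR : ℤ) ≤ ∑ r ∈ c.support, (r : ℤ) * c r)
    (hme : (m : ℤ) + e ≤ ∑ r ∈ a.support, (r : ℤ) * a r) :
    (d - 2) * k + ∑ r ∈ a.support ∪ b.support ∪ c.support,
        ((r : ℤ) - m * (d - 1)) * t r ≤ 0 ∧
      (0 < ∑ r ∈ a.support ∪ b.support ∪ c.support, t r →
        -(((d : ℝ) - 2) * (k : ℝ)
              + ∑ r ∈ a.support ∪ b.support ∪ c.support, (r : ℝ) * t r)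
            / (∑ r ∈ a.support ∪ b.support ∪ c.support, (t r : ℝ))
          ≥ -((m : ℝ) * ((d : ℝ) - 1))) := by
  set S := a.support ∪ b.support ∪ c.support with hS
  have extend (f : ℕ →₀ ℕ) (w : ℕ → ℤ) (hf : f.support ⊆ S) :
      ∑ r ∈ f.support, w r * f r = ∑ r ∈ S, w r * f r := by
    refine Finset.sum_subset hf fun r _ hr => ?_
    simp [Finsupp.notMem_support_iff.mp hr]
  have haS : a.support ⊆ S := fun r hr => by simp only [hS, Finset.mem_union]; tauto
  have hbS : b.support ⊆ S := fun r hr => by simp only [hS, Finset.mem_union]; tauto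
  have hcS : c.support ⊆ S := fun r hr => by simp only [hS, Finset.mem_union]; tauto
  have hnb : (n : ℤ) ≤ nR + ∑ r ∈ b.support, (r : ℤ) * b r := by
    rw [hn]
    push_cast
    gcongr
    omega
  rw [extend a _ haS] at hme
  rw [extend b _ hbS] at hnb
  rw [extend c _ hcS] at hnR
  have hkt : k ≤ ∑ r ∈ S, (r : ℤ) * t r := by
    have hsum : ∑ r ∈ S, (r : ℤ) * t r = ∑ r ∈ S, (r : ℤ) * a r
        + ∑ r ∈ S, (r : ℤ) * b r + ∑ r ∈ S, (r : ℤ) * c r := by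
      rw [← Finset.sum_add_distrib, ← Finset.sum_add_distrib]
      refine Finset.sum_congr rfl fun r _ => ?_
      rw [ht r]
      push_cast
      ring
    linarith
  have hrt : ∑ r ∈ S, (r : ℤ) * t r ≤ m * ∑ r ∈ S, (t r : ℤ) := by
    rw [Finset.mul_sum]
    refine Finset.sum_le_sum fun r _ => ?_
    by_cases hr : 2 ≤ r ∧ r ≤ m
    · have : (r : ℤ) ≤ m := by exact_mod_cast hr.2
      gcongr
    · obtain ⟨h₁, h₂, h₃⟩ := hsupp r hr
      simp [ht, h₁, h₂, h₃]
  have key : (d - 2) * k + ∑ r ∈ S, (r : ℤ) * t r ≤ m * (d - 1) * ∑ r ∈ S, (t r : ℤ) := by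
    have h₁ := mul_le_mul_of_nonneg_left hkt (show 0 ≤ d - 2 by linarith)
    have h₂ := mul_le_mul_of_nonneg_left hrt (show 0 ≤ d - 1 by linarith)
    linarith
  refine ⟨?_, fun hpos => ?_⟩
  · simp only [sub_mul, Finset.sum_sub_distrib, ← Finset.mul_sum] at key ⊢
    linarith
  · have hpos' : (0 : ℝ) < ∑ r ∈ S, (t r : ℝ) := by exact_mod_cast hpos
    have key' : ((d : ℝ) - 2) * k + ∑ r ∈ S, (r : ℝ) * t r
        ≤ m * ((d : ℝ) - 1) * ∑ r ∈ S, (t r : ℝ) := by exact_mod_cast key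
    rw [ge_iff_le, le_div_iff₀ hpos']
    linarith
end

section
/- Let t : ℕ → ℕ be a finitely supported function with t(0) = t(1) = 0 and ∑_{r≥2} t(r) ≥ 1, and let k be a natural number with k(k−1) = ∑_{r≥2} (r² − r)·t(r). If t(2) ≥ 3 + ∑_{r≥4} (r − 3)·t(r) (Melchior's inequality), then ( k² − ∑_{r≥2} r²·t(r) ) / ( ∑_{r≥2} t(r) ) ≥ −3. -/
/-- Arithmetic form of Theorem 4.1 (Laface–Pokora): for a configuration of `k`
real lines (not a pencil), the combinatorial identity `k(k-1) = ∑ (r²-r) t_r`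
together with Melchior's inequality yields the Harbourne constant bound `≥ -3`. -/
theorem stmt_10 (t : ℕ →₀ ℕ) (ht0 : t 0 = 0) (ht1 : t 1 = 0)
    (hf0 : 1 ≤ ∑ r ∈ t.support.filter (fun r => 2 ≤ r), t r)
    (k : ℕ)
    (hk : k * (k - 1) = ∑ r ∈ t.support.filter (fun r => 2 ≤ r), (r ^ 2 - r) * t r)
    (hMel : t 2 ≥ 3 + ∑ r ∈ t.support.filter (fun r => 4 ≤ r), (r - 3) * t r) :
    ((k : ℝ) ^ 2 - ∑ r ∈ t.support.filter (fun r => 2 ≤ r), (r : ℝ) ^ 2 * t r)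
        / (∑ r ∈ t.support.filter (fun r => 2 ≤ r), (t r : ℝ))
      ≥ -3 := by
  set S := t.support.filter (fun r => 2 ≤ r) with hS
  have hf0' : (1 : ℝ) ≤ ∑ r ∈ S, (t r : ℝ) := by exact_mod_cast hf0
  have hk' : (k : ℝ) ^ 2 - k = ∑ r ∈ S, (r : ℝ) ^ 2 * t r - ∑ r ∈ S, (r : ℝ) * t r := by
    have hleft : ((k * (k - 1) : ℕ) : ℝ) = (k : ℝ) ^ 2 - k := by
      rcases k with _ | k
      · simp
      · push_cast [Nat.add_sub_cancel]
        ring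
    rw [← hleft, hk, Nat.cast_sum, ← Finset.sum_sub_distrib]
    refine Finset.sum_congr rfl fun r _ => ?_
    rw [Nat.cast_mul, Nat.cast_sub (Nat.le_self_pow two_ne_zero r), Nat.cast_pow]
    ring
  have h2 : 2 ∈ S := by
    rw [hS, Finset.mem_filter, Finsupp.mem_support_iff]
    omega
  have hfilter : t.support.filter (fun r => 4 ≤ r) = S.filter (fun r => 4 ≤ r) := by
    rw [hS, Finset.filter_filter]
    exact Finset.filter_congr fun r _ => by omega
  have hMel' : (3 : ℝ) + ∑ r ∈ S, (if 4 ≤ r then ((r : ℝ) - 3) * t r else 0) ≤ t 2 := by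
    rw [← Finset.sum_filter, ← hfilter]
    calc _ = ((3 + ∑ r ∈ t.support.filter (fun r => 4 ≤ r), (r - 3) * t r : ℕ) : ℝ) := by
          push_cast
          congr 1
          refine Finset.sum_congr rfl fun r hr => ?_
          rw [Nat.cast_sub (by have := (Finset.mem_filter.mp hr).2; omega)]
          norm_num
      _ ≤ t 2 := by exact_mod_cast hMel
  have hsplit : ∑ r ∈ S, (if 4 ≤ r then ((r : ℝ) - 3) * t r else 0)
      = ∑ r ∈ S, (r : ℝ) * t r - 3 * ∑ r ∈ S, (t r : ℝ) + t 2 := by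
    have hsingle : (t 2 : ℝ) = ∑ r ∈ S, (if r = 2 then (t r : ℝ) else 0) := by
      rw [Finset.sum_ite_eq', if_pos h2]
    rw [hsingle, Finset.mul_sum, ← Finset.sum_sub_distrib, ← Finset.sum_add_distrib]
    refine Finset.sum_congr rfl fun r hr => ?_
    have hr2 : 2 ≤ r := (Finset.mem_filter.mp hr).2
    obtain rfl | rfl | hr4 : r = 2 ∨ r = 3 ∨ 4 ≤ r := by omega
    · norm_num
      ring
    · norm_num
    · rw [if_pos hr4, if_neg (by omega)]
      ring
  have hk0 : (0 : ℝ) ≤ k := k.cast_nonneg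
  rw [ge_iff_le, le_div_iff₀ (by linarith)]
  linarith
end
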